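/- arXiv:1912.13434 — 2 statements merged into one kernel-verified Lean document; each statement's English description precedes it below -/
import Mathlib

section
/- Let θ : ℕ → ℝ be a sequence with θ(k) ≥ 0 for all k, such that for every x ∈ [0,1) the series ∑_{k≥0} θ(k)·x^k converges with sum equal to 1 - 3/((√((4-x)/(1-x)) + 1)² - 1). Then k^{5/2}·θ(k) converges to (1/2)·√(3/π) as k → ∞; equivalently, θ(k) ~ (1/2)·√(3/π)·k^{-5/2}. -/
open Filter Topology Set

theorem factorial_mul_multichoose_eq_prod (s : ℝ) (n : ℕ) :
    (n.factorial : ℝ) * Ring.multichoose s n = ∏ j ∈ Finset.range n, (s + j) := by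
  rw [← nsmul_eq_mul, Ring.factorial_nsmul_multichoose_eq_ascPochhammer,
    Polynomial.ascPochhammer_smeval_cast, Polynomial.ascPochhammer_smeval_eq_eval]
  induction n with
  | zero => simp
  | succ n ih => rw [ascPochhammer_succ_eval, ih, Finset.prod_range_succ]

theorem hasSum_multichoose_mul_pow (s : ℝ) {x : ℝ} (hx : |x| < 1) :
    HasSum (fun n ↦ Ring.multichoose s n * x ^ n) (1 / (1 - x) ^ s) := by
  have h := (Real.one_div_one_sub_rpow_hasFPowerSeriesOnBall_zero s).hasSum (y := x)
    (by simpa [enorm_eq_nnnorm] using! hx)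
  simpa [FormalMultilinearSeries.ofScalars_apply_eq, Ring.multichoose_eq, mul_comm] using h

theorem tendsto_rpow_mul_multichoose {s : ℝ} (hs : ∀ m : ℕ, s ≠ -m) :
    Tendsto (fun n : ℕ ↦ (n : ℝ) ^ (1 - s) * Ring.multichoose s n) atTop
      (𝓝 (Real.Gamma s)⁻¹) := by
  have hG := (Real.GammaSeq_tendsto_Gamma s).inv₀ (Real.Gamma_ne_zero hs)
  have h := hG.mul (tendsto_natCast_div_add_atTop s)
  rw [mul_one] at h
  refine h.congr' ?_
  filter_upwards [eventually_gt_atTop 0] with n hn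
  have hn' : (0 : ℝ) < n := by exact_mod_cast hn
  have hsn : s + n ≠ 0 := fun h0 ↦ hs n (by linarith)
  have hsn' : (n : ℝ) + s ≠ 0 := by rwa [add_comm]
  have hf : (n.factorial : ℝ) ≠ 0 := by positivity
  have hp : (n : ℝ) ^ s ≠ 0 := by positivity
  rw [Real.GammaSeq, Finset.prod_range_succ, ← factorial_mul_multichoose_eq_prod,
    Real.rpow_sub hn', Real.rpow_one, inv_div]
  field_simp
  ring

theorem abs_multichoose_half_le_one (n : ℕ) : |Ring.multichoose (1 / 2 : ℝ) n| ≤ 1 := by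
  have h := factorial_mul_multichoose_eq_prod (1 / 2) n
  have h0 : 0 ≤ ∏ j ∈ Finset.range n, (1 / 2 + j : ℝ) :=
    Finset.prod_nonneg fun _ _ ↦ by positivity
  have h1 : ∏ j ∈ Finset.range n, (1 / 2 + j : ℝ) ≤ n.factorial := by
    rw [← Finset.prod_range_add_one_eq_factorial]
    push_cast
    exact Finset.prod_le_prod (fun _ _ ↦ by positivity) fun _ _ ↦ by linarith
  have hf : (0 : ℝ) < n.factorial := by positivity
  rw [abs_le]
  constructor <;> nlinarith

theorem tendsto_add_rpow_mul {a : ℕ → ℝ} {A p : ℝ}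
    (ha : Tendsto (fun n : ℕ ↦ (n : ℝ) ^ p * a n) atTop (𝓝 A)) (k : ℕ) :
    Tendsto (fun n : ℕ ↦ ((n + k : ℕ) : ℝ) ^ p * a n) atTop (𝓝 A) := by
  have h := ((tendsto_natCast_div_add_atTop (k : ℝ)).rpow_const
    (p := -p) (Or.inl one_ne_zero)).mul ha
  rw [Real.one_rpow, one_mul] at h
  refine h.congr' ?_
  filter_upwards [eventually_gt_atTop 0] with n hn
  have hn' : (0 : ℝ) < n := by exact_mod_cast hn
  have : (n : ℝ) ^ p ≠ 0 := by positivity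
  rw [Real.rpow_neg (by positivity), Real.div_rpow (by positivity) (by positivity)]
  push_cast
  field_simp

theorem tendsto_rpow_mul_of_add {b : ℕ → ℝ} {B p : ℝ}
    (hb : Tendsto (fun n : ℕ ↦ (n : ℝ) ^ p * b n) atTop (𝓝 B)) (k : ℕ) :
    Tendsto (fun n : ℕ ↦ (n : ℝ) ^ p * b (n + k)) atTop (𝓝 B) := by
  have h := ((tendsto_natCast_div_add_atTop (k : ℝ)).rpow_const
    (p := p) (Or.inl one_ne_zero)).mul ((tendsto_add_atTop_iff_nat k).2 hb)
  rw [Real.one_rpow, one_mul] at h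
  refine h.congr' ?_
  filter_upwards [eventually_gt_atTop 0] with n hn
  have hn' : (0 : ℝ) < n := by exact_mod_cast hn
  have : ((n : ℝ) + k) ^ p ≠ 0 := by positivity
  rw [Real.div_rpow (by positivity) (by positivity)]
  push_cast
  field_simp

/-- Convolving a sequence of order `n ^ (-p)` with a rapidly decaying one multiplies the leading
constant by the sum of the latter. -/
theorem tendsto_rpow_mul_convolution {a c : ℕ → ℝ} {A C p : ℝ} (hp : 0 ≤ p)
    (ha : Tendsto (fun n : ℕ ↦ (n : ℝ) ^ p * a n) atTop (𝓝 A)) (hc : HasSum c C)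
    (hcs : Summable fun k : ℕ ↦ ((k : ℝ) + 1) ^ p * |c k|) :
    Tendsto (fun n : ℕ ↦ (n : ℝ) ^ p * ∑ k ∈ Finset.range (n + 1), c k * a (n - k)) atTop
      (𝓝 (C * A)) := by
  obtain ⟨M, hM⟩ := ha.abs.bddAbove_range
  set K := max M |a 0|
  have hK : ∀ n k : ℕ, k ≤ n → (n : ℝ) ^ p * |a (n - k)| ≤ ((k : ℝ) + 1) ^ p * K := by
    intro n k hk
    obtain ⟨m, rfl⟩ := Nat.exists_eq_add_of_le hk
    rw [Nat.add_sub_cancel_left]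
    rcases Nat.eq_zero_or_pos m with rfl | hm
    · refine mul_le_mul (Real.rpow_le_rpow (by positivity) (by simp) hp) (le_max_right _ _)
        (abs_nonneg _) (by positivity)
    · have hm' : (1 : ℝ) ≤ m := by exact_mod_cast hm
      have h1 : |(m : ℝ) ^ p * a m| ≤ M := hM ⟨m, rfl⟩
      rw [abs_mul, abs_of_nonneg (by positivity)] at h1
      calc ((k + m : ℕ) : ℝ) ^ p * |a m| ≤ (((k : ℝ) + 1) * m) ^ p * |a m| := by
            gcongr
            push_cast
            nlinarith [(k.cast_nonneg : (0 : ℝ) ≤ k)]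
        _ = ((k : ℝ) + 1) ^ p * ((m : ℝ) ^ p * |a m|) := by
            rw [Real.mul_rpow (by positivity) (by positivity), mul_assoc]
        _ ≤ _ := by
            gcongr
            exact h1.trans (le_max_left _ _)
  let f : ℕ → ℕ → ℝ := fun n k ↦ if k ≤ n then (n : ℝ) ^ p * (c k * a (n - k)) else 0
  have hf : Tendsto (fun n ↦ ∑' k, f n k) atTop (𝓝 (∑' k, c k * A)) := by
    refine tendsto_tsum_of_dominated_convergence (hcs.mul_right K) (fun k ↦ ?_)
      (.of_forall fun n k ↦ ?_)
    · rw [← tendsto_add_atTop_iff_nat k]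
      refine ((tendsto_add_rpow_mul ha k).const_mul (c k)).congr fun n ↦ ?_
      simp only [f, Nat.le_add_left, if_true, Nat.add_sub_cancel]
      ring
    · by_cases hk : k ≤ n
      · simp only [f, hk, if_true, Real.norm_eq_abs, abs_mul]
        rw [abs_of_nonneg (by positivity : (0 : ℝ) ≤ (n : ℝ) ^ p)]
        nlinarith [mul_le_mul_of_nonneg_left (hK n k hk) (abs_nonneg (c k))]
      · simp only [f, hk, if_false, norm_zero]
        have : 0 ≤ K := (abs_nonneg _).trans (le_max_right _ _)
        positivity
  rw [tsum_mul_right, hc.tsum_eq] at hf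
  refine hf.congr fun n ↦ ?_
  rw [tsum_eq_sum (s := Finset.range (n + 1)), Finset.mul_sum]
  · refine Finset.sum_congr rfl fun k hk ↦ ?_
    simp only [f, Nat.lt_succ_iff.1 (Finset.mem_range.1 hk), if_true]
  · intro k hk
    simp only [Finset.mem_range, Nat.lt_succ_iff] at hk
    simp only [f, hk, if_false]

theorem eq_zero_of_hasSum_mul_pow_zero {d : ℕ → ℝ}
    (hd : ∀ x ∈ Ico (0 : ℝ) 1, HasSum (fun n ↦ d n * x ^ n) 0) : d = 0 := by
  set P := FormalMultilinearSeries.ofScalars ℝ d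
  have hr : ((1 / 2 : NNReal) : ENNReal) ≤ P.radius := by
    refine P.le_radius_of_summable ?_
    have h := (hd (1 / 2) (by norm_num)).summable.norm
    simpa [P, FormalMultilinearSeries.ofScalars_norm] using h
  have hP : HasFPowerSeriesAt P.sum P 0 :=
    (P.hasFPowerSeriesOnBall (lt_of_lt_of_le (by simp) hr)).hasFPowerSeriesAt
  rw [← FormalMultilinearSeries.ofScalars_series_eq_zero (E := ℝ)]
  by_contra hne
  have h1 : ∀ᶠ x in 𝓝[>] (0 : ℝ), P.sum x ≠ 0 :=
    (hP.locally_ne_zero hne).filter_mono (nhdsWithin_mono _ fun x hx ↦ ne_of_gt hx)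
  obtain ⟨x, hx, hx'⟩ := (h1.and (Ioo_mem_nhdsGT one_pos)).exists
  refine hx ?_
  have h2 := (hd x ⟨hx'.1.le, hx'.2⟩).tsum_eq
  simpa [FormalMultilinearSeries.sum, P, FormalMultilinearSeries.ofScalars_apply_eq, mul_comm]
    using h2

theorem mul_skeleton_gen_eq {x : ℝ} (hx : x ∈ Ico (0 : ℝ) 1) :
    x * (1 - 3 / ((Real.sqrt ((4 - x) / (1 - x)) + 1) ^ 2 - 1)) =
      1 / (1 - x / 4) ^ (1 / 2 : ℝ) * (1 / (1 - x) ^ (-(3 / 2) : ℝ)) - 1 + 2 * x := by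
  obtain ⟨hx0, hx1⟩ := hx
  have hb : 0 < 1 - x := by linarith
  have ha : 0 < 4 - x := by linarith
  have e1 : (1 - x / 4) ^ (1 / 2 : ℝ) = Real.sqrt (4 - x) / 2 := by
    rw [← Real.sqrt_eq_rpow, show 1 - x / 4 = (4 - x) / 2 ^ 2 by ring,
      Real.sqrt_div ha.le, Real.sqrt_sq (by norm_num)]
  have e2 : 1 / (1 - x) ^ (-(3 / 2) : ℝ) = (1 - x) * Real.sqrt (1 - x) := by
    rw [Real.rpow_neg hb.le, one_div, inv_inv, show (3 / 2 : ℝ) = 1 + 1 / 2 by norm_num,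
      Real.rpow_add hb, Real.rpow_one, Real.sqrt_eq_rpow]
  rw [e1, e2, Real.sqrt_div ha.le]
  have ha' := Real.sqrt_pos.2 ha
  have hb' := Real.sqrt_pos.2 hb
  have hsa := Real.sq_sqrt ha.le
  have hsb := Real.sq_sqrt hb.le
  set u := Real.sqrt (4 - x)
  set v := Real.sqrt (1 - x)
  have e3 : 3 / ((u / v + 1) ^ 2 - 1) = 3 * v ^ 2 / (u * (u + 2 * v)) := by
    have : (u / v + 1) ^ 2 - 1 = u * (u + 2 * v) / v ^ 2 := by
      field_simp
      ring
    rw [this, div_div_eq_mul_div]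
  have hxv : x = 1 - v ^ 2 := by linarith
  have huv : u ^ 2 = 3 + v ^ 2 := by linarith
  rw [e3, hxv]
  field_simp
  linear_combination v ^ 2 * huv

theorem stmt_5 (θ : ℕ → ℝ) (hnn : ∀ k, 0 ≤ θ k)
    (hgen : ∀ x ∈ Set.Ico (0 : ℝ) 1,
      HasSum (fun k : ℕ => θ k * x ^ k)
        (1 - 3 / ((Real.sqrt ((4 - x) / (1 - x)) + 1) ^ 2 - 1))) :
    Filter.Tendsto (fun k : ℕ => (k : ℝ) ^ (5 / 2 : ℝ) * θ k) Filter.atTop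
      (nhds ((1 / 2) * Real.sqrt (3 / Real.pi))) := by
  set a : ℕ → ℝ := fun n ↦ Ring.multichoose (-(3 / 2) : ℝ) n
  set c : ℕ → ℝ := fun n ↦ Ring.multichoose (1 / 2 : ℝ) n * (1 / 4) ^ n
  set b : ℕ → ℝ := fun n ↦ ∑ k ∈ Finset.range (n + 1), c k * a (n - k)
  have hbsum : ∀ x ∈ Ico (0 : ℝ) 1, HasSum (fun n ↦ b n * x ^ n)
      (1 / (1 - x / 4) ^ (1 / 2 : ℝ) * (1 / (1 - x) ^ (-(3 / 2) : ℝ))) := by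
    rintro x ⟨hx0, hx1⟩
    have hA := hasSum_multichoose_mul_pow (-(3 / 2)) (x := x) (by rwa [abs_of_nonneg hx0])
    have hC := hasSum_multichoose_mul_pow (1 / 2) (x := x / 4)
      (by rw [abs_of_nonneg (by positivity)]; linarith)
    have h := hasSum_sum_range_mul_of_summable_norm hC.summable.norm hA.summable.norm
    rw [hA.tsum_eq, hC.tsum_eq] at h
    refine Eq.subst (motive := fun f ↦ HasSum f _) (funext fun n ↦ ?_) h
    rw [Finset.sum_mul]
    refine Finset.sum_congr rfl fun k hk ↦ ?_
    rw [← pow_sub_mul_pow x (Nat.lt_succ_iff.1 (Finset.mem_range.1 hk)), div_pow]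
    simp only [a, c, one_div, inv_pow]
    ring
  have hd : (fun n ↦ b n - (if n = 0 then 0 else θ (n - 1)) - (if n = 0 then 1 else 0)
      + (if n = 1 then 2 else 0)) = 0 := by
    refine eq_zero_of_hasSum_mul_pow_zero fun x hx ↦ ?_
    have hθ : HasSum (fun n ↦ (if n = 0 then 0 else θ (n - 1)) * x ^ n)
        (x * (1 - 3 / ((Real.sqrt ((4 - x) / (1 - x)) + 1) ^ 2 - 1))) := by
      rw [← hasSum_nat_add_iff' 1]
      simpa [pow_succ, mul_comm, mul_left_comm] using (hgen x hx).mul_left x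
    have h0 : HasSum (fun n ↦ (if n = 0 then (1 : ℝ) else 0) * x ^ n) 1 := by
      convert hasSum_single (f := fun n ↦ (if n = 0 then (1 : ℝ) else 0) * x ^ n) 0
        (by simp +contextual) using 1
      simp
    have h1 : HasSum (fun n ↦ (if n = 1 then (2 : ℝ) else 0) * x ^ n) (2 * x) := by
      convert hasSum_single (f := fun n ↦ (if n = 1 then (2 : ℝ) else 0) * x ^ n) 1
        (by simp +contextual) using 1
      simp
    have h := (((hbsum x hx).sub hθ).sub h0).add h1
    rw [mul_skeleton_gen_eq hx] at h
    rw [show ∀ X : ℝ, X - (X - 1 + 2 * x) - 1 + 2 * x = 0 by intro X; ring] at h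
    simpa only [Pi.zero_apply, add_mul, sub_mul] using h
  have hθb : ∀ k, 1 ≤ k → b (k + 1) = θ k := by
    intro k hk
    have h := congrFun hd (k + 1)
    simp [show k ≠ 0 by omega] at h
    linarith
  have hcs : Summable fun k : ℕ ↦ ((k : ℝ) + 1) ^ (5 / 2 : ℝ) * |c k| := by
    have h := (summable_nat_add_iff 1).2
      (summable_pow_mul_geometric_of_norm_lt_one 3 (r := (1 / 4 : ℝ)) (by norm_num))
    refine (h.mul_left 4).of_nonneg_of_le (fun k ↦ by positivity) fun k ↦ ?_
    have h1 : ((k : ℝ) + 1) ^ (5 / 2 : ℝ) ≤ ((k : ℝ) + 1) ^ 3 := by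
      rw [← Real.rpow_natCast]
      exact Real.rpow_le_rpow_of_exponent_le (by simp) (by norm_num)
    have h2 : |c k| ≤ (1 / 4) ^ k := by
      rw [abs_mul, abs_of_nonneg (by positivity : (0 : ℝ) ≤ (1 / 4) ^ k)]
      exact mul_le_of_le_one_left (by positivity) (abs_multichoose_half_le_one k)
    calc _ ≤ ((k : ℝ) + 1) ^ 3 * (1 / 4) ^ k := by gcongr
      _ = _ := by
        push_cast
        ring
  have ha := tendsto_rpow_mul_multichoose (s := -(3 / 2)) (by
    intro m hm
    have : (3 : ℝ) = ((2 * m : ℕ) : ℝ) := by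
      push_cast
      linarith
    norm_cast at this
    omega)
  rw [show (1 - -(3 / 2) : ℝ) = 5 / 2 by norm_num] at ha
  have hb := tendsto_rpow_mul_convolution (by norm_num) ha
    (hasSum_multichoose_mul_pow (1 / 2) (x := 1 / 4) (by norm_num [abs_lt])) hcs
  have hG : Real.Gamma (-(3 / 2)) = 4 / 3 * Real.sqrt Real.pi := by
    have h1 := Real.Gamma_add_one (s := -(3 / 2)) (by norm_num)
    have h2 := Real.Gamma_add_one (s := -(1 / 2)) (by norm_num)
    rw [show (-(3 / 2) + 1 : ℝ) = -(1 / 2) by norm_num] at h1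
    rw [show (-(1 / 2) + 1 : ℝ) = 1 / 2 by norm_num, Real.Gamma_one_half_eq] at h2
    linarith
  have hconst : 1 / (1 - 1 / 4 : ℝ) ^ (1 / 2 : ℝ) * (Real.Gamma (-(3 / 2)))⁻¹ =
      1 / 2 * Real.sqrt (3 / Real.pi) := by
    have hpi := Real.sqrt_pos.2 Real.pi_pos
    have h3 : 0 < Real.sqrt 3 := by positivity
    have h3' := Real.sq_sqrt (show (0 : ℝ) ≤ 3 by norm_num)
    rw [hG, ← Real.sqrt_eq_rpow, show (1 - 1 / 4 : ℝ) = 3 / 2 ^ 2 by norm_num,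
      Real.sqrt_div (by norm_num), Real.sqrt_div (by norm_num), Real.sqrt_sq (by norm_num)]
    field_simp
    linarith
  rw [hconst] at hb
  refine (tendsto_rpow_mul_of_add hb 1).congr' ?_
  filter_upwards [eventually_ge_atTop 1] with k hk
  rw [← hθb k hk]
end

section
/- Fix an integer r ≥ 1. Let a : ℕ → ℝ be a sequence with a(k) ≥ 0 for all k, such that for every x ∈ [0,1) the series ∑_{k≥0} a(k)·x^k converges with sum equal to 1 - 3/((√((4-x)/(1-x)) + r)² - 1). Then k^{5/2}·a(k) converges to √(3/π)·(r/2) as k → ∞; equivalently, a(k) ~ √(3/π)·(r/2)·k^{-5/2}. -/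
open Real Set Filter Topology MeasureTheory

/-- Two real power series with the same sum on a right neighbourhood of `0` are equal. -/
theorem eq_of_hasSum_pow_Ioo {a b : ℕ → ℝ} {f : ℝ → ℝ} {δ : ℝ} (hδ : 0 < δ)
    (ha : ∀ x ∈ Ioo 0 δ, HasSum (fun k => a k * x ^ k) (f x))
    (hb : ∀ x ∈ Ioo 0 δ, HasSum (fun k => b k * x ^ k) (f x)) : a = b := by
  set d : ℕ → ℝ := fun k => a k - b k with hd
  have hsum : ∀ x ∈ Ioo 0 δ, HasSum (fun k => d k * x ^ k) 0 := fun x hx => by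
    simpa [hd, sub_mul] using (ha x hx).sub (hb x hx)
  let p : FormalMultilinearSeries ℝ ℝ ℝ := FormalMultilinearSeries.ofScalars ℝ d
  have hp : HasFPowerSeriesAt (fun z => ∑' k, d k * z ^ k) p 0 := by
    rw [hasFPowerSeriesAt_iff]
    filter_upwards [Metric.ball_mem_nhds (0 : ℝ) (half_pos hδ)] with z hz
    have hz' : |z| < δ / 2 := by simpa using hz
    have hs := (hsum (δ / 2) ⟨by linarith, by linarith⟩).summable.abs
    have : Summable fun k => d k * z ^ k := by
      refine Summable.of_norm_bounded hs fun k => ?_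
      rw [norm_mul, norm_pow, abs_mul, abs_pow, abs_of_pos (half_pos hδ)]
      simp only [Real.norm_eq_abs]
      gcongr
    simpa [p, FormalMultilinearSeries.coeff_ofScalars, mul_comm] using this.hasSum
  have hp0 : p = 0 := by
    by_contra hne
    have h1 : ∀ᶠ z in 𝓝[>] (0 : ℝ), ∑' k, d k * z ^ k ≠ 0 :=
      (hp.locally_ne_zero hne).filter_mono (nhdsWithin_mono _ fun z hz => ne_of_gt hz)
    obtain ⟨z, hz, hz'⟩ := (h1.and (Ioo_mem_nhdsGT hδ)).exists
    exact hz (hsum z hz').tsum_eq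
  funext k
  have : p.coeff k = 0 := by rw [hp0]; rfl
  rw [FormalMultilinearSeries.coeff_ofScalars] at this
  exact sub_eq_zero.mp this

theorem tendsto_const_mul_arctan_const_mul_atTop {c : ℝ} (hc : 0 ≤ c) :
    Tendsto (fun w => c * arctan (c * w)) atTop (𝓝 (c * (π / 2))) := by
  rcases hc.eq_or_lt with rfl | hc
  · simp
  · exact ((tendsto_arctan_atTop.mono_right nhdsWithin_le_nhds).comp
      (tendsto_id.const_mul_atTop hc)).const_mul c

theorem hasDerivAt_const_mul_arctan_const_mul (c w : ℝ) :
    HasDerivAt (fun w => c * arctan (c * w)) (c ^ 2 / (1 + c ^ 2 * w ^ 2)) w := by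
  convert! (((hasDerivAt_id w).const_mul c).arctan).const_mul c using 1
  simp only [id_eq, mul_pow]
  ring

/-- An antiderivative of `1 / ((1 + m² w²) (1 + s² w²))` vanishing at `0`, with its limit. -/
theorem exists_hasDerivAt_inv_one_add_sq_mul_inv_one_add_sq {m s : ℝ} (hm : 0 ≤ m) (hs : 0 < s) :
    ∃ F : ℝ → ℝ, F 0 = 0 ∧
      (∀ w, HasDerivAt F (1 / ((1 + m ^ 2 * w ^ 2) * (1 + s ^ 2 * w ^ 2))) w) ∧
      Tendsto F atTop (𝓝 (π / (2 * (m + s)))) := by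
  rcases eq_or_ne m s with rfl | hne
  · refine ⟨fun w => (w / (1 + m ^ 2 * w ^ 2) + m * arctan (m * w) / m ^ 2) / 2, by simp,
      fun w => ?_, ?_⟩
    · have h1 : 1 + m ^ 2 * w ^ 2 ≠ 0 := by positivity
      have hden : HasDerivAt (fun w : ℝ => 1 + m ^ 2 * w ^ 2) (m ^ 2 * (2 * w)) w := by
        simpa using ((hasDerivAt_pow 2 w).const_mul (m ^ 2)).const_add 1
      convert! (((hasDerivAt_id w).div hden h1).add
        ((hasDerivAt_const_mul_arctan_const_mul m w).div_const (m ^ 2))).div_const 2 using 1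
      simp only [id_eq]
      field_simp
      ring
    · have h0 : Tendsto (fun w : ℝ => w / (1 + m ^ 2 * w ^ 2)) atTop (𝓝 0) := by
        have hi := tendsto_inv_atTop_zero (𝕜 := ℝ)
        have := hi.div ((hi.pow 2).add_const (m ^ 2)) (by positivity)
        rw [zero_div] at this
        refine this.congr' ?_
        filter_upwards [eventually_gt_atTop 0] with w hw
        simp only [Pi.div_apply]
        field_simp
      convert (h0.add ((tendsto_const_mul_arctan_const_mul_atTop hm).div_const (m ^ 2))).div_const 2
        using 2
      field_simp
      ring
  · have hsub : s - m ≠ 0 := sub_ne_zero.mpr hne.symm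
    have hadd : s + m ≠ 0 := by positivity
    have hsq : s ^ 2 - m ^ 2 ≠ 0 := by
      rw [sq_sub_sq]; exact mul_ne_zero hadd hsub
    refine ⟨fun w => (s * arctan (s * w) - m * arctan (m * w)) / (s ^ 2 - m ^ 2), by simp,
      fun w => ?_, ?_⟩
    · convert! ((hasDerivAt_const_mul_arctan_const_mul s w).sub
        (hasDerivAt_const_mul_arctan_const_mul m w)).div_const (s ^ 2 - m ^ 2) using 1
      have h1 : 1 + m ^ 2 * w ^ 2 ≠ 0 := by positivity
      have h2 : 1 + s ^ 2 * w ^ 2 ≠ 0 := by positivity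
      field_simp
      ring
    · convert ((tendsto_const_mul_arctan_const_mul_atTop hs.le).sub
        (tendsto_const_mul_arctan_const_mul_atTop hm)).div_const (s ^ 2 - m ^ 2) using 2
      rw [sq_sub_sq, add_comm m s]
      field_simp

theorem integrableOn_inv_one_add_sq_mul_inv_one_add_sq {m s : ℝ} (hm : 0 ≤ m) (hs : 0 < s) :
    IntegrableOn (fun w : ℝ => 1 / ((1 + m ^ 2 * w ^ 2) * (1 + s ^ 2 * w ^ 2))) (Ioi 0) := by
  obtain ⟨F, -, hF, hlim⟩ := exists_hasDerivAt_inv_one_add_sq_mul_inv_one_add_sq hm hs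
  exact integrableOn_Ioi_deriv_of_nonneg' (fun w _ => hF w) (fun w _ => by positivity) hlim

theorem integral_inv_one_add_sq_mul_inv_one_add_sq {m s : ℝ} (hm : 0 ≤ m) (hs : 0 < s) :
    ∫ w in Ioi (0 : ℝ), 1 / ((1 + m ^ 2 * w ^ 2) * (1 + s ^ 2 * w ^ 2)) = π / (2 * (m + s)) := by
  obtain ⟨F, hF0, hF, hlim⟩ := exists_hasDerivAt_inv_one_add_sq_mul_inv_one_add_sq hm hs
  rw [integral_Ioi_of_hasDerivAt_of_nonneg' (fun w _ => hF w) (fun w _ => by positivity) hlim,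
    hF0, sub_zero]

/-- The common ratio in the moment representation of the coefficients. -/
noncomputable def momentRatio (w : ℝ) : ℝ := (1 + w ^ 2) / (1 + 4 * w ^ 2)

/-- The density in the moment representation of the coefficients. -/
noncomputable def momentWeight (r w : ℝ) : ℝ :=
  12 * r * w ^ 4 /
    ((1 + 4 * w ^ 2) ^ 2 * (1 + (r - 1) ^ 2 * w ^ 2) * (1 + (r + 1) ^ 2 * w ^ 2))

theorem momentRatio_pos (w : ℝ) : 0 < momentRatio w := by
  unfold momentRatio; positivity

theorem momentRatio_le_one (w : ℝ) : momentRatio w ≤ 1 := by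
  unfold momentRatio
  rw [div_le_one (by positivity)]
  nlinarith [sq_nonneg w]

theorem momentWeight_nonneg {r : ℝ} (hr : 0 ≤ r) (w : ℝ) : 0 ≤ momentWeight r w := by
  unfold momentWeight; positivity

theorem continuous_momentRatio : Continuous momentRatio := by
  unfold momentRatio
  exact Continuous.div (by fun_prop) (by fun_prop) fun w => by positivity

theorem continuous_momentWeight (r : ℝ) : Continuous (momentWeight r) := by
  unfold momentWeight
  exact Continuous.div (by fun_prop) (by fun_prop) fun w => by positivity

theorem momentWeight_le {r : ℝ} (hr : 0 ≤ r) (w : ℝ) :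
    momentWeight r w ≤ 12 * r * w ^ 4 / (1 + w ^ 2) ^ 3 := by
  unfold momentWeight
  gcongr
  calc (1 + w ^ 2) ^ 3 = (1 + w ^ 2) ^ 2 * 1 * (1 + w ^ 2) := by ring
    _ ≤ _ := by
      gcongr
      · nlinarith [sq_nonneg w]
      · nlinarith [sq_nonneg ((r - 1) * w)]
      · nlinarith [sq_nonneg w, mul_nonneg hr (sq_nonneg w), sq_nonneg (r * w)]

theorem pow_four_div_one_add_sq_pow_three_le (w : ℝ) :
    w ^ 4 / (1 + w ^ 2) ^ 3 ≤ (1 + w ^ 2)⁻¹ := by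
  rw [inv_eq_one_div, div_le_div_iff₀ (by positivity) (by positivity)]
  have := sq_nonneg w
  nlinarith [mul_nonneg this this, sq_nonneg (1 + w ^ 2)]

theorem momentWeight_mul_pow_le {r : ℝ} (hr : 0 ≤ r) (w : ℝ) (n : ℕ) :
    momentWeight r w * momentRatio w ^ n ≤ 12 * r * (1 + w ^ 2)⁻¹ := by
  calc momentWeight r w * momentRatio w ^ n ≤ momentWeight r w * 1 := by
        gcongr
        · exact momentWeight_nonneg hr w
        · exact pow_le_one₀ (momentRatio_pos w).le (momentRatio_le_one w)
    _ ≤ 12 * r * (w ^ 4 / (1 + w ^ 2) ^ 3) := by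
        rw [mul_one, ← mul_div_assoc]; exact momentWeight_le hr w
    _ ≤ _ := by gcongr; exact pow_four_div_one_add_sq_pow_three_le w

theorem integrable_momentWeight_mul_pow {r : ℝ} (hr : 0 ≤ r) (n : ℕ) :
    Integrable fun w => momentWeight r w * momentRatio w ^ n := by
  refine (integrable_inv_one_add_sq.const_mul (12 * r)).mono'
    ((continuous_momentWeight r).mul (continuous_momentRatio.pow n)).aestronglyMeasurable
    (ae_of_all _ fun w => ?_)
  rw [norm_of_nonneg (mul_nonneg (momentWeight_nonneg hr w) (pow_nonneg (momentRatio_pos w).le n))]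
  exact momentWeight_mul_pow_le hr w n

/-- The uniform bound behind dominated convergence, from Bernoulli's inequality. -/
theorem momentRatio_pow_le {n : ℕ} (hn : 3 ≤ n) (w : ℝ) :
    momentRatio w ^ n ≤ ((1 + w ^ 2) / (1 + (n + 1) * w ^ 2)) ^ 3 := by
  have hw : 0 < 1 + w ^ 2 := by positivity
  have hn' : (1 : ℝ) ≤ n / 3 := by
    rw [le_div_iff₀ (by norm_num)]; exact_mod_cast hn
  have hb := one_add_mul_self_le_rpow_one_add (s := 3 * w ^ 2 / (1 + w ^ 2))
    (by linarith [show 0 ≤ 3 * w ^ 2 / (1 + w ^ 2) by positivity]) hn'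
  have hinv : 1 + 3 * w ^ 2 / (1 + w ^ 2) = (momentRatio w)⁻¹ := by
    unfold momentRatio; field_simp; ring
  have hlhs : 1 + (n : ℝ) / 3 * (3 * w ^ 2 / (1 + w ^ 2))
      = ((1 + w ^ 2) / (1 + (n + 1) * w ^ 2))⁻¹ := by field_simp; ring
  rw [hinv, hlhs, inv_rpow (momentRatio_pos w).le,
    inv_le_inv₀ (by positivity) (rpow_pos_of_pos (momentRatio_pos w) _)] at hb
  calc momentRatio w ^ n = (momentRatio w ^ ((n : ℝ) / 3)) ^ 3 := by
        rw [← rpow_natCast, ← rpow_natCast, ← rpow_mul (momentRatio_pos w).le]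
        congr 1; push_cast; ring
    _ ≤ _ := by gcongr; exact (rpow_pos_of_pos (momentRatio_pos w) _).le

theorem sq_mul_momentWeight_mul_pow_le {r : ℝ} (hr : 0 ≤ r) {n : ℕ} (hn : 3 ≤ n) {w v : ℝ}
    (hv : (n + 1) * w ^ 2 = v ^ 2) :
    (n + 1 : ℝ) ^ 2 * (momentWeight r w * momentRatio w ^ n) ≤ 12 * r * (1 + v ^ 2)⁻¹ := by
  calc (n + 1 : ℝ) ^ 2 * (momentWeight r w * momentRatio w ^ n)
      ≤ (n + 1 : ℝ) ^ 2 * (12 * r * w ^ 4 / (1 + w ^ 2) ^ 3 *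
        ((1 + w ^ 2) / (1 + (n + 1) * w ^ 2)) ^ 3) := by
        gcongr
        · exact pow_nonneg (momentRatio_pos w).le n
        · exact momentWeight_le hr w
        · exact momentRatio_pow_le hn w
    _ = 12 * r * (v ^ 4 / (1 + v ^ 2) ^ 3) := by
        rw [← hv, show v ^ 4 = (v ^ 2) ^ 2 by ring, ← hv]
        field_simp
    _ ≤ _ := by gcongr; exact pow_four_div_one_add_sq_pow_three_le v

theorem tendsto_sq_mul_momentWeight_mul_pow (r v : ℝ) :
    Tendsto (fun n : ℕ => (n + 1 : ℝ) ^ 2 * (momentWeight r ((√(n + 1))⁻¹ * v) *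
      momentRatio ((√(n + 1))⁻¹ * v) ^ n)) atTop (𝓝 (12 * r * (v ^ 4 * exp (-3 * v ^ 2)))) := by
  set p : ℕ → ℝ := fun n => v ^ 2 / (n + 1) with hp
  have hsq (n : ℕ) : ((√(n + 1 : ℝ))⁻¹ * v) ^ 2 = p n := by
    rw [mul_pow, inv_pow, sq_sqrt (by positivity), hp]; ring
  have hp0 : Tendsto p atTop (𝓝 0) := by
    have := (tendsto_one_div_add_atTop_nhds_zero_nat (𝕜 := ℝ)).const_mul (v ^ 2)
    simpa [hp, div_eq_mul_inv] using this
  have hnp : Tendsto (fun n : ℕ => n * p n) atTop (𝓝 (v ^ 2)) := by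
    have : (fun n : ℕ => n * p n) = fun n => v ^ 2 - p n := by
      funext n; simp only [hp]; field_simp; ring
    rw [this]; simpa using hp0.const_sub (v ^ 2)
  have hratio : Tendsto (fun n : ℕ => momentRatio ((√(n + 1))⁻¹ * v) ^ n) atTop
      (𝓝 (exp (-3 * v ^ 2))) := by
    have hg : Tendsto (fun n : ℕ => n * (-3 * p n / (1 + 4 * p n))) atTop (𝓝 (-3 * v ^ 2)) := by
      have h4 : Tendsto (fun n => 1 + 4 * p n) atTop (𝓝 1) := by
        simpa using (hp0.const_mul 4).const_add 1
      have := (hnp.const_mul (-3)).div h4 one_ne_zero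
      rw [div_one] at this
      refine this.congr fun n => ?_
      simp only [Pi.div_apply]; ring
    refine (tendsto_one_add_pow_exp_of_tendsto hg).congr fun n => ?_
    have : 0 ≤ p n := by simp only [hp]; positivity
    rw [momentRatio, hsq]
    congr 1; field_simp; ring
  have hweight : Tendsto (fun n : ℕ => (n + 1 : ℝ) ^ 2 * momentWeight r ((√(n + 1))⁻¹ * v))
      atTop (𝓝 (12 * r * v ^ 4)) := by
    have h (c : ℝ) : Tendsto (fun n => 1 + c * p n) atTop (𝓝 1) := by
      simpa using (hp0.const_mul c).const_add 1
    have := (tendsto_const_nhds (x := 12 * r * v ^ 4)).div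
      ((((h 4).pow 2).mul (h ((r - 1) ^ 2))).mul (h ((r + 1) ^ 2))) (by norm_num)
    norm_num only at this
    rw [div_one] at this
    refine this.congr fun n => ?_
    have h4 : ((√(n + 1 : ℝ))⁻¹ * v) ^ 4 = p n ^ 2 := by rw [← hsq]; ring
    have h5 : (n + 1 : ℝ) ^ 2 * p n ^ 2 = v ^ 4 := by simp only [hp]; field_simp
    rw [momentWeight, hsq, h4, Pi.div_apply, ← h5]
    ring
  simpa only [mul_assoc] using hweight.mul hratio

theorem integral_pow_four_mul_exp_neg_three_mul_sq :
    ∫ v in Ioi (0 : ℝ), v ^ 4 * exp (-3 * v ^ 2) = √(3 / π) * π / 72 := by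
  have h := integral_rpow_mul_exp_neg_mul_rpow (p := 2) (q := 4) (b := 3) (by norm_num)
    (by norm_num) (by norm_num)
  have hΓ : Gamma ((4 + 1) / 2) = 3 / 4 * √π := by
    rw [show ((4 : ℝ) + 1) / 2 = 3 / 2 + 1 by norm_num, Gamma_add_one (by norm_num),
      show (3 : ℝ) / 2 = 1 / 2 + 1 by norm_num, Gamma_add_one (by norm_num), Gamma_one_half_eq]
    ring
  have h3 : (3 : ℝ) ^ (-(4 + 1 : ℝ) / 2) = √3 / 27 := by
    rw [show -(4 + 1 : ℝ) / 2 = 1 / 2 + (-3 : ℤ) by norm_num, rpow_add_intCast (by norm_num),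
      ← sqrt_eq_rpow]
    norm_num; ring
  rw [hΓ, h3] at h
  calc _ = ∫ v in Ioi (0 : ℝ), v ^ (4 : ℝ) * exp (-3 * v ^ (2 : ℝ)) := by
        norm_cast
    _ = _ := by
        rw [h, sqrt_div (by norm_num)]
        have : √π ≠ 0 := by positivity
        field_simp
        rw [sq_sqrt pi_pos.le]
        ring

theorem tendsto_rpow_mul_integral_momentWeight {r : ℝ} (hr : 0 ≤ r) :
    Tendsto (fun n : ℕ => (n + 1 : ℝ) ^ (5 / 2 : ℝ) *
      (3 / π * ∫ w in Ioi (0 : ℝ), momentWeight r w * momentRatio w ^ n)) atTop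
      (𝓝 (√(3 / π) * (r / 2))) := by
  have hlim : Tendsto (fun n : ℕ => ∫ v in Ioi (0 : ℝ), (n + 1 : ℝ) ^ 2 *
      (momentWeight r ((√(n + 1))⁻¹ * v) * momentRatio ((√(n + 1))⁻¹ * v) ^ n)) atTop
      (𝓝 (∫ v in Ioi (0 : ℝ), 12 * r * (v ^ 4 * exp (-3 * v ^ 2)))) := by
    refine tendsto_integral_filter_of_dominated_convergence (fun v => 12 * r * (1 + v ^ 2)⁻¹)
      (Eventually.of_forall fun n => ?_) ?_
      (integrable_inv_one_add_sq.const_mul (12 * r)).integrableOn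
      (ae_of_all _ fun v => tendsto_sq_mul_momentWeight_mul_pow r v)
    · have hc : Continuous fun v : ℝ => (√(n + 1))⁻¹ * v := continuous_const_mul _
      exact (continuous_const.mul (((continuous_momentWeight r).comp hc).mul
        ((continuous_momentRatio.comp hc).pow n))).aestronglyMeasurable
    · filter_upwards [eventually_ge_atTop 3] with n hn
      refine ae_of_all _ fun v => ?_
      rw [norm_of_nonneg (mul_nonneg (by positivity) (mul_nonneg (momentWeight_nonneg hr _)
        (pow_nonneg (momentRatio_pos _).le n)))]
      refine sq_mul_momentWeight_mul_pow_le hr hn ?_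
      rw [mul_pow, inv_pow, sq_sqrt (by positivity)]
      field_simp
  have := hlim.const_mul (3 / π)
  rw [integral_const_mul, integral_pow_four_mul_exp_neg_three_mul_sq] at this
  convert this using 2 with n
  · have hn : (0 : ℝ) < n + 1 := by positivity
    have hpow : (n + 1 : ℝ) ^ (5 / 2 : ℝ) = (n + 1) ^ 2 * √(n + 1) := by
      rw [show (5 / 2 : ℝ) = 1 / 2 + (2 : ℕ) by norm_num, rpow_add_natCast hn.ne', ← sqrt_eq_rpow,
        mul_comm]
    rw [integral_const_mul, integral_comp_mul_left_Ioi
      (fun w => momentWeight r w * momentRatio w ^ n) 0 (inv_pos.mpr (sqrt_pos.mpr hn)),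
      mul_zero, inv_inv, smul_eq_mul, hpow]
    ring
  · field_simp; ring

/-- For `s = √((4 - x) / (1 - x))`, expansion of `1 / (1 + s² w²)` in powers of `x`. -/
theorem hasSum_momentWeight_mul_pow (r w : ℝ) {x : ℝ} (hx : x ∈ Ioo (0 : ℝ) 1) :
    HasSum (fun n : ℕ => momentWeight r w * momentRatio w ^ n * x ^ (n + 1))
      ((1 / (1 + (r - 1) ^ 2 * w ^ 2) - 1 / (1 + (r + 1) ^ 2 * w ^ 2)) *
        (1 / (1 + 2 ^ 2 * w ^ 2) - 1 / (1 + (4 - x) / (1 - x) * w ^ 2))) := by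
  have hq0 := momentRatio_pos w
  have hqx : momentRatio w * x < 1 := by
    nlinarith [hx.1, hx.2, momentRatio_le_one w]
  have h := (hasSum_geometric_of_lt_one (mul_nonneg hq0.le hx.1.le) hqx).mul_left
    (momentWeight r w * x)
  convert! h using 1
  · funext n; rw [mul_pow]; ring
  · have h1 : (1 : ℝ) - x ≠ 0 := by linarith [hx.2]
    have hpos : (1 : ℝ) + 4 * w ^ 2 - x * (1 + w ^ 2) ≠ 0 := by
      nlinarith [hx.1, hx.2, sq_nonneg w, mul_nonneg (sub_nonneg.mpr hx.2.le) (sq_nonneg w)]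
    have e1 : 1 + (4 - x) / (1 - x) * w ^ 2
        = (1 + 4 * w ^ 2 - x * (1 + w ^ 2)) / (1 - x) := by field_simp; ring
    have e2 : 1 - momentRatio w * x
        = (1 + 4 * w ^ 2 - x * (1 + w ^ 2)) / (1 + 4 * w ^ 2) := by
      unfold momentRatio; field_simp
    have hm : 1 + (r - 1) ^ 2 * w ^ 2 ≠ 0 := by positivity
    have hp : 1 + (r + 1) ^ 2 * w ^ 2 ≠ 0 := by positivity
    have h4 : 1 + 4 * w ^ 2 ≠ 0 := by positivity
    obtain ⟨D, hD⟩ : ∃ D, D = 1 + 4 * w ^ 2 - x * (1 + w ^ 2) := ⟨_, rfl⟩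
    rw [← hD] at hpos e1 e2
    rw [e1, e2, momentWeight]
    norm_num only
    field_simp
    rw [hD]
    ring

/-- The sum of the moment series, evaluated by partial fractions. -/
theorem hasSum_integral_momentWeight_mul_pow {r : ℝ} (hr : 1 ≤ r) {x : ℝ}
    (hx : x ∈ Ioo (0 : ℝ) 1) :
    HasSum (fun n : ℕ => (3 / π * ∫ w in Ioi (0 : ℝ), momentWeight r w * momentRatio w ^ n) *
        x ^ (n + 1))
      (3 / ((2 + r) ^ 2 - 1) - 3 / ((√((4 - x) / (1 - x)) + r) ^ 2 - 1)) := by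
  have hr0 : 0 ≤ r := zero_le_one.trans hr
  have hdiv : 0 < (4 - x) / (1 - x) := div_pos (by linarith [hx.2]) (by linarith [hx.2])
  set s := √((4 - x) / (1 - x))
  have hs : 0 < s := sqrt_pos.mpr hdiv
  have hs2 : s ^ 2 = (4 - x) / (1 - x) := sq_sqrt hdiv.le
  have hsum := hasSum_integral_of_summable_integral_norm
    (F := fun (n : ℕ) (w : ℝ) => momentWeight r w * momentRatio w ^ n * x ^ (n + 1))
    (μ := volume.restrict (Ioi 0))
    (fun n => ((integrable_momentWeight_mul_pow hr0 n).mul_const _).integrableOn) ?_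
  swap
  · refine Summable.of_nonneg_of_le (fun n => integral_nonneg fun w => norm_nonneg _) (fun n => ?_)
      ((summable_geometric_of_lt_one hx.1.le hx.2).mul_left
        (∫ w in Ioi (0 : ℝ), momentWeight r w))
    rw [← integral_mul_const]
    have hint : IntegrableOn (momentWeight r) (Ioi 0) := by
      simpa using (integrable_momentWeight_mul_pow hr0 0).integrableOn
    refine integral_mono ((integrable_momentWeight_mul_pow hr0 n).mul_const _).integrableOn.norm
      (hint.mul_const _) fun w => ?_
    have hw := momentWeight_nonneg hr0 w
    have hq := momentRatio_pos w
    have hx0 := hx.1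
    rw [norm_of_nonneg (by positivity), mul_assoc]
    refine mul_le_mul_of_nonneg_left ?_ hw
    calc momentRatio w ^ n * x ^ (n + 1) ≤ 1 * x ^ n := by
          gcongr ?_ * ?_
          · exact pow_le_one₀ hq.le (momentRatio_le_one w)
          · exact pow_le_pow_of_le_one hx0.le hx.2.le n.le_succ
      _ = x ^ n := one_mul _
  have hval : ∫ w in Ioi (0 : ℝ), ∑' n : ℕ, momentWeight r w * momentRatio w ^ n * x ^ (n + 1)
      = π / (2 * (r - 1 + 2)) - π / (2 * (r + 1 + 2)) -
        (π / (2 * (r - 1 + s)) - π / (2 * (r + 1 + s))) := by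
    have hm : 0 ≤ r - 1 := sub_nonneg.mpr hr
    have hp : 0 ≤ r + 1 := by positivity
    have I (m c : ℝ) (hm : 0 ≤ m) (hc : 0 < c) :=
      integrableOn_inv_one_add_sq_mul_inv_one_add_sq hm hc
    have J (c : ℝ) (hc : 0 < c) : IntegrableOn (fun w : ℝ =>
        1 / ((1 + (r - 1) ^ 2 * w ^ 2) * (1 + c ^ 2 * w ^ 2)) -
          1 / ((1 + (r + 1) ^ 2 * w ^ 2) * (1 + c ^ 2 * w ^ 2))) (Ioi 0) :=
      (I _ _ hm hc).sub (I _ _ hp hc)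
    rw [← integral_inv_one_add_sq_mul_inv_one_add_sq hm two_pos,
      ← integral_inv_one_add_sq_mul_inv_one_add_sq hp two_pos,
      ← integral_inv_one_add_sq_mul_inv_one_add_sq hm hs,
      ← integral_inv_one_add_sq_mul_inv_one_add_sq hp hs,
      ← integral_sub (I _ _ hm two_pos) (I _ _ hp two_pos),
      ← integral_sub (I _ _ hm hs) (I _ _ hp hs), ← integral_sub (J _ two_pos) (J _ hs)]
    refine integral_congr_ae (ae_of_all _ fun w => ?_)
    simp only
    rw [(hasSum_momentWeight_mul_pow r w hx).tsum_eq, ← hs2]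
    simp only [one_div, mul_inv]
    ring
  rw [hval] at hsum
  convert! hsum.mul_left (3 / π) using 1
  · funext n
    rw [integral_mul_const, mul_assoc]
  · have e (c : ℝ) (hc : 0 < c) :
        3 / ((c + r) ^ 2 - 1) = 3 / π * (π / (2 * (r - 1 + c)) - π / (2 * (r + 1 + c))) := by
      have h1 : r - 1 + c ≠ 0 := by linarith
      have h2 : r + 1 + c ≠ 0 := by linarith
      have h3 : (c + r) ^ 2 - 1 = (r - 1 + c) * (r + 1 + c) := by ring
      rw [h3]
      field_simp
      ring
    rw [e 2 two_pos, e s hs]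
    ring

theorem stmt_6 (r : ℕ) (hr : 1 ≤ r) (a : ℕ → ℝ) (hnn : ∀ k, 0 ≤ a k)
    (hgen : ∀ x ∈ Set.Ico (0 : ℝ) 1,
      HasSum (fun k : ℕ => a k * x ^ k)
        (1 - 3 / ((Real.sqrt ((4 - x) / (1 - x)) + r) ^ 2 - 1))) :
    Filter.Tendsto (fun k : ℕ => (k : ℝ) ^ (5 / 2 : ℝ) * a k) Filter.atTop
      (nhds (Real.sqrt (3 / Real.pi) * (r / 2))) := by
  have hr' : (1 : ℝ) ≤ r := by exact_mod_cast hr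
  let b : ℕ → ℝ := fun n => 3 / π * ∫ w in Ioi (0 : ℝ), momentWeight r w * momentRatio w ^ n
  let c : ℕ → ℝ := fun k => Nat.casesOn k (1 - 3 / ((2 + (r : ℝ)) ^ 2 - 1)) b
  have hac : a = c := by
    refine eq_of_hasSum_pow_Ioo one_pos (fun x hx => hgen x ⟨hx.1.le, hx.2⟩) fun x hx => ?_
    rw [← hasSum_nat_add_iff' 1]
    convert! hasSum_integral_momentWeight_mul_pow hr' hx using 1
    simp [c]
  rw [← tendsto_add_atTop_iff_nat 1, hac]
  simpa [c, b] using tendsto_rpow_mul_integral_momentWeight (zero_le_one.trans hr')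
end
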